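/- Let G ≤ S_n be a permutation group not generated by transpositions, and let < be any admissible term order on monomials in x_1, ..., x_n. Then the monoid of initial exponents in_<(K[x]^G) = {u ∈ ℕ^n : x^u ≥ x^{g·u} for all g ∈ G} has infinitely many irreducible elements; consequently the invariant ring K[x_1,...,x_n]^G has no finite SAGBI basis with respect to <. -/

import Mathlib

/-- `a ≥_lex 0`: all entries zero, or the first nonzero entry is positive. -/
def lexGe {n : ℕ} (a : Fin n → ℝ) : Prop :=
  (∀ j, a j = 0) ∨ ∃ i, (∀ j, j < i → a j = 0) ∧ 0 < a i

/-- `a >_lex 0`: the first nonzero entry exists and is positive. -/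
def lexGt {n : ℕ} (a : Fin n → ℝ) : Prop :=
  ∃ i, (∀ j, j < i → a j = 0) ∧ 0 < a i

/-- Action of a permutation on ℝ^n by permuting coordinates: (σ·v)ᵢ = v_{σ⁻¹ i}. -/
def permAct {n : ℕ} (σ : Equiv.Perm (Fin n)) (v : Fin n → ℝ) : Fin n → ℝ :=
  fun i => v (σ⁻¹ i)

/-- The monoid of initial exponents of G-invariants: u ∈ ℕ^n with
x^u ≥ x^{g·u} for all g ∈ G, where the term order is given by the linear
forms l₁, …, lₙ. -/
def initialMonoid {n : ℕ} (G : Subgroup (Equiv.Perm (Fin n)))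
    (l : Fin n → ((Fin n → ℝ) →ₗ[ℝ] ℝ)) : Set (Fin n → ℕ) :=
  {u | ∀ g ∈ G,
    lexGe fun k => l k ((fun i => (u i : ℝ)) - permAct g (fun i => (u i : ℝ)))}

theorem lexGe_iff_toLex_nonneg {n : ℕ} (a : Fin n → ℝ) : lexGe a ↔ 0 ≤ toLex a := by
  rw [le_iff_eq_or_lt]
  refine or_congr ?_ ?_
  · constructor
    · intro h
      exact (congrArg toLex (funext h : a = 0)).symm
    · intro h j
      exact (congrFun h j).symm
  · refine exists_congr fun i => and_congr ?_ Iff.rfl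
    exact forall₂_congr fun j _ => eq_comm

theorem permAct_mul {n : ℕ} (σ τ : Equiv.Perm (Fin n)) (v : Fin n → ℝ) :
    permAct (σ * τ) v = permAct σ (permAct τ v) := by
  funext i
  simp [permAct]

theorem permAct_one {n : ℕ} (v : Fin n → ℝ) : permAct 1 v = v := by
  funext i
  simp [permAct]

theorem permAct_inv_cancel {n : ℕ} (σ : Equiv.Perm (Fin n)) (v : Fin n → ℝ) :
    permAct σ⁻¹ (permAct σ v) = v := by
  rw [← permAct_mul, inv_mul_cancel, permAct_one]

theorem continuous_permAct {n : ℕ} (σ : Equiv.Perm (Fin n)) : Continuous (permAct σ) :=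
  continuous_pi fun i => continuous_apply (σ⁻¹ i)

theorem sum_permAct {n : ℕ} (σ : Equiv.Perm (Fin n)) (v : Fin n → ℝ) :
    ∑ i, permAct σ v i = ∑ i, v i :=
  Equiv.sum_comp σ⁻¹ v

theorem apply_perm_of_permAct_eq {n : ℕ} {σ : Equiv.Perm (Fin n)} {v : Fin n → ℝ}
    (h : permAct σ v = v) (i : Fin n) : v (σ i) = v i := by
  have := congrFun h (σ i)
  simpa [permAct] using this.symm

/-- The real vectors that are lexicographically maximal in their `G`-orbit. -/
def maximalCone {n : ℕ} (G : Subgroup (Equiv.Perm (Fin n)))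
    (l : Fin n → ((Fin n → ℝ) →ₗ[ℝ] ℝ)) : Set (Fin n → ℝ) :=
  {v | ∀ g ∈ G, lexGe fun k => l k (v - permAct g v)}

section

variable {n : ℕ} {G : Subgroup (Equiv.Perm (Fin n))} {l : Fin n → ((Fin n → ℝ) →ₗ[ℝ] ℝ)}

theorem lexGe.add {a b : Fin n → ℝ} (ha : lexGe a) (hb : lexGe b) : lexGe (a + b) := by
  rw [lexGe_iff_toLex_nonneg] at *
  exact add_nonneg ha hb

theorem lexGe.smul {a : Fin n → ℝ} (ha : lexGe a) {c : ℝ} (hc : 0 ≤ c) : lexGe (c • a) := by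
  rcases hc.eq_or_lt with rfl | hc
  · exact Or.inl fun j => by simp
  rcases ha with ha | ⟨i, hi, hpos⟩
  · exact Or.inl fun j => by simp [ha j]
  · exact Or.inr ⟨i, fun j hj => by simp [hi j hj], by simpa using mul_pos hc hpos⟩

theorem zero_mem_maximalCone : (0 : Fin n → ℝ) ∈ maximalCone G l := fun g _ =>
  Or.inl fun j => by
    have : permAct g (0 : Fin n → ℝ) = 0 := rfl
    simp [this]

theorem add_mem_maximalCone {v w : Fin n → ℝ} (hv : v ∈ maximalCone G l)
    (hw : w ∈ maximalCone G l) : v + w ∈ maximalCone G l := fun g hg => by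
  have := (hv g hg).add (hw g hg)
  convert this using 1
  funext k
  have h : permAct g (v + w) = permAct g v + permAct g w := rfl
  simp [h]
  ring

theorem smul_mem_maximalCone {v : Fin n → ℝ} (hv : v ∈ maximalCone G l) {c : ℝ} (hc : 0 ≤ c) :
    c • v ∈ maximalCone G l := fun g hg => by
  have := (hv g hg).smul hc
  convert this using 1
  funext k
  have h : permAct g (c • v) = c • permAct g v := rfl
  simp [h]
  ring

theorem sum_smul_mem_maximalCone {S : Finset (Fin n → ℕ)} (hS : ↑S ⊆ initialMonoid G l)
    {c : (Fin n → ℕ) → ℝ} (hc : ∀ s, 0 ≤ c s) :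
    ∑ s ∈ S, c s • (fun i => (s i : ℝ)) ∈ maximalCone G l := by
  refine Finset.sum_induction _ (· ∈ maximalCone G l) (fun _ _ => add_mem_maximalCone)
    zero_mem_maximalCone fun s hs => smul_mem_maximalCone ?_ (hc s)
  exact hS hs

theorem eq_zero_of_lexGe_of_lexGe_neg (hli : LinearIndependent ℝ l) {v : Fin n → ℝ}
    (h₁ : lexGe fun k => l k v) (h₂ : lexGe fun k => l k (-v)) : v = 0 := by
  have h : ∀ k, l k v = 0 := by
    rw [lexGe_iff_toLex_nonneg] at h₁ h₂
    have h₃ : toLex (fun k => l k (-v)) = -toLex (fun k => l k v) := by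
      have : (fun k => l k (-v)) = -(fun k => l k v) := by
        funext k
        simp
      rw [this]
      rfl
    rw [h₃, neg_nonneg] at h₂
    have h₄ := le_antisymm h₂ h₁
    exact fun k => congrFun h₄ k
  have hspan : Submodule.span ℝ (Set.range l) = ⊤ :=
    hli.span_eq_top_of_card_eq_finrank' (by simp [Subspace.dual_finrank_eq])
  refine (Module.forall_dual_apply_eq_zero_iff ℝ v).1 fun φ => ?_
  have hφ : φ ∈ Submodule.span ℝ (Set.range l) := hspan ▸ Submodule.mem_top
  induction hφ using Submodule.span_induction with
  | mem x hx =>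
    obtain ⟨k, rfl⟩ := hx
    exact h k
  | zero => rfl
  | add x y _ _ hx hy => simp [hx, hy]
  | smul a x _ hx => simp [hx]

theorem permAct_eq_of_mem_maximalCone (hli : LinearIndependent ℝ l) {g : Equiv.Perm (Fin n)}
    (hg : g ∈ G) {v : Fin n → ℝ} (hv : v ∈ maximalCone G l)
    (hgv : permAct g v ∈ maximalCone G l) : permAct g v = v := by
  have h₁ := hv g hg
  have h₂ := hgv g⁻¹ (inv_mem hg)
  rw [permAct_inv_cancel, ← neg_sub] at h₂
  exact (sub_eq_zero.1 (eq_zero_of_lexGe_of_lexGe_neg hli h₁ h₂)).symm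

theorem exists_comp_inv_mem_initialMonoid (u : Fin n → ℕ) :
    ∃ g ∈ G, (fun i => u (g⁻¹ i)) ∈ initialMonoid G l := by
  obtain ⟨⟨g, hg⟩, hmax⟩ := Finite.exists_max fun g : G =>
    toLex fun k => l k (permAct g (fun i => (u i : ℝ)))
  refine ⟨g, hg, fun h hh => ?_⟩
  rw [lexGe_iff_toLex_nonneg]
  have := sub_nonneg.2 (hmax ⟨h * g, mul_mem hh hg⟩)
  simp only [permAct_mul] at this
  convert this using 1
  rw [← toLex_sub]
  congr 1
  funext k
  rw [map_sub]
  rfl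

theorem exists_bounded_coeff_of_mem_closure {S : Finset (Fin n → ℕ)} {u : Fin n → ℕ}
    (hu : u ∈ AddSubmonoid.closure (S : Set (Fin n → ℕ))) :
    ∃ c : (Fin n → ℕ) → ℕ, (∀ s, c s ≤ ∑ i, u i) ∧ u = ∑ s ∈ S, c s • s := by
  classical
  induction hu using AddSubmonoid.closure_induction with
  | mem s hs =>
    by_cases h0 : s = 0
    · exact ⟨0, by simp, by simp [h0]⟩
    · refine ⟨Pi.single s 1, fun t => ?_, ?_⟩
      · have : 1 ≤ ∑ i, s i := by
          by_contra! hlt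
          refine h0 (funext fun i => ?_)
          have := Finset.single_le_sum (f := s) (fun i _ => Nat.zero_le _) (Finset.mem_univ i)
          simp only [Pi.zero_apply]
          omega
        refine le_trans ?_ this
        by_cases hts : t = s
        · simp [hts]
        · simp [hts]
      · rw [Finset.sum_eq_single s]
        · simp
        · intro t _ hts
          simp [hts]
        · exact fun h => absurd hs h
  | zero => exact ⟨0, by simp, by simp⟩
  | add x y _ _ hx hy =>
    obtain ⟨c, hc, hxc⟩ := hx
    obtain ⟨d, hd, hyd⟩ := hy
    refine ⟨c + d, fun s => ?_, ?_⟩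
    · simpa [Finset.sum_add_distrib] using add_le_add (hc s) (hd s)
    · simp only [Pi.add_apply, add_smul, Finset.sum_add_distrib]
      rw [← hxc, ← hyd]

/-- The combinations of `S` with real coefficients in `[0, D]`. -/
def boundedCone (S : Finset (Fin n → ℕ)) (D : ℝ) : Set (Fin n → ℝ) :=
  (fun c : (Fin n → ℕ) → ℝ => ∑ s ∈ S, c s • fun i => (s i : ℝ)) '' Set.Icc 0 (fun _ => D)

theorem isClosed_boundedCone (S : Finset (Fin n → ℕ)) (D : ℝ) : IsClosed (boundedCone S D) := by
  have hcompact : IsCompact (Set.Icc (0 : (Fin n → ℕ) → ℝ) (fun _ => D)) := by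
    rw [← Set.pi_univ_Icc]
    exact isCompact_univ_pi fun _ => isCompact_Icc
  exact (hcompact.image (by fun_prop)).isClosed

theorem boundedCone_subset {S : Finset (Fin n → ℕ)} (hS : ↑S ⊆ initialMonoid G l) (D : ℝ) :
    boundedCone S D ⊆ maximalCone G l := by
  rintro _ ⟨c, hc, rfl⟩
  exact sum_smul_mem_maximalCone hS hc.1

theorem isClosed_setOf_exists_permAct_mem (T : Set (Equiv.Perm (Fin n))) {C : Set (Fin n → ℝ)}
    (hC : IsClosed C) : IsClosed {z | ∃ g ∈ T, permAct g z ∈ C} := by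
  have : {z | ∃ g ∈ T, permAct g z ∈ C} = ⋃ g ∈ T, permAct g ⁻¹' C := by
    ext z
    simp
  rw [this]
  exact T.toFinite.isClosed_biUnion fun g _ => hC.preimage (continuous_permAct g)

theorem exists_permAct_mem_boundedCone {S : Finset (Fin n → ℕ)}
    (hgen : ∀ u ∈ initialMonoid G l, u ∈ AddSubmonoid.closure (S : Set (Fin n → ℕ)))
    {D : ℝ} {z : Fin n → ℝ} (hz : ∀ i, 0 ≤ z i) (hD : ∑ i, z i ≤ D) :
    ∃ g ∈ G, permAct g z ∈ boundedCone S D := by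
  have hlim : Filter.Tendsto (fun (N : ℕ) i => (⌊z i * (N : ℝ)⌋₊ : ℝ) / (N : ℝ)) Filter.atTop
      (nhds z) :=
    tendsto_pi_nhds.2 fun i =>
      (tendsto_nat_floor_mul_div_atTop (hz i)).comp tendsto_natCast_atTop_atTop
  refine (isClosed_setOf_exists_permAct_mem (G : Set _) (isClosed_boundedCone S D)).mem_of_tendsto
    hlim ?_
  filter_upwards [Filter.eventually_gt_atTop 0] with N hN
  have hN' : (0 : ℝ) < N := by exact_mod_cast hN
  obtain ⟨g, hg, hmem⟩ := exists_comp_inv_mem_initialMonoid (G := G) (l := l)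
    (fun i => ⌊z i * (N : ℝ)⌋₊)
  refine ⟨g, hg, ?_⟩
  obtain ⟨c, hc, hsum⟩ := exists_bounded_coeff_of_mem_closure (hgen _ hmem)
  refine ⟨fun s => (c s : ℝ) / N, ⟨fun s => ?_, fun s => ?_⟩, ?_⟩
  · exact div_nonneg (Nat.cast_nonneg _) hN'.le
  · have h₁ : ((c s : ℕ) : ℝ) ≤ ∑ i, (⌊z i * (N : ℝ)⌋₊ : ℝ) := by
      have := hc s
      rw [Equiv.sum_comp g⁻¹ (fun i => ⌊z i * (N : ℝ)⌋₊)] at this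
      exact_mod_cast this
    have h₂ : ∑ i, (⌊z i * (N : ℝ)⌋₊ : ℝ) ≤ (∑ i, z i) * N := by
      rw [Finset.sum_mul]
      exact Finset.sum_le_sum fun i _ => Nat.floor_le (mul_nonneg (hz i) hN'.le)
    change (c s : ℝ) / N ≤ D
    rw [div_le_iff₀ hN']
    exact h₁.trans (h₂.trans (mul_le_mul_of_nonneg_right hD hN'.le))
  · funext i
    have h := congrArg (Nat.cast : ℕ → ℝ) (congrFun hsum i)
    simp only [Finset.sum_apply, Pi.smul_apply, smul_eq_mul, Nat.cast_sum, Nat.cast_mul] at h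
    simp only [Finset.sum_apply, Pi.smul_apply, smul_eq_mul, permAct, h, Finset.sum_div]
    exact Finset.sum_congr rfl fun s _ => by ring

theorem inv_mul_mem_of_segment (hli : LinearIndependent ℝ l) {S : Finset (Fin n → ℕ)}
    (hS : ↑S ⊆ initialMonoid G l)
    (hgen : ∀ u ∈ initialMonoid G l, u ∈ AddSubmonoid.closure (S : Set (Fin n → ℕ)))
    {H : Subgroup (Equiv.Perm (Fin n))} {x y : Fin n → ℝ} (hx : ∀ i, 0 ≤ x i)
    (hy : ∀ i, 0 ≤ y i)
    (hseg : ∀ z ∈ segment ℝ x y, ∀ g ∈ G, g ∉ H → permAct g z ≠ z)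
    {g g' : Equiv.Perm (Fin n)} (hg : g ∈ G) (hg' : g' ∈ G)
    {D : ℝ} (hxD : ∑ i, x i ≤ D) (hyD : ∑ i, y i ≤ D)
    (hgx : permAct g x ∈ boundedCone S D) (hgy : permAct g' y ∈ boundedCone S D) :
    g⁻¹ * g' ∈ H := by
  by_contra hH
  have hconn : IsPreconnected (segment ℝ x y) := (convex_segment x y).isPreconnected
  have hsame : ∀ z ∈ segment ℝ x y, ∀ a ∈ G, ∀ b ∈ G, permAct a z ∈ boundedCone S D →
      permAct b z ∈ boundedCone S D → a⁻¹ * b ∈ H := by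
    intro z hz a ha b hb haz hbz
    by_contra hab
    refine hseg z hz _ (mul_mem (inv_mem ha) hb) hab ?_
    have hcancel : permAct (b * a⁻¹) (permAct a z) = permAct b z := by
      rw [← permAct_mul, inv_mul_cancel_right]
    have h := permAct_eq_of_mem_maximalCone hli (mul_mem hb (inv_mem ha))
      (boundedCone_subset hS D haz) (by rw [hcancel]; exact boundedCone_subset hS D hbz)
    rw [permAct_mul, ← hcancel, h, permAct_inv_cancel]
  have hC := isClosed_boundedCone S D
  obtain ⟨z, hz, ⟨a, ⟨ha, haH⟩, haz⟩, b, ⟨hb, hbH⟩, hbz⟩ := isPreconnected_closed_iff.1 hconn _ _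
    (isClosed_setOf_exists_permAct_mem {a | a ∈ G ∧ g⁻¹ * a ∈ H} hC)
    (isClosed_setOf_exists_permAct_mem {a | a ∈ G ∧ g⁻¹ * a ∉ H} hC)
    (by
      rintro z ⟨s, t, hs, ht, hst, rfl⟩
      obtain ⟨a, ha, haz⟩ := exists_permAct_mem_boundedCone (G := G) (l := l) hgen (D := D)
        (z := s • x + t • y)
        (fun i => add_nonneg (mul_nonneg hs (hx i)) (mul_nonneg ht (hy i)))
        (by
          simp only [Pi.add_apply, Pi.smul_apply, smul_eq_mul, Finset.sum_add_distrib,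
            ← Finset.mul_sum]
          calc _ ≤ s * D + t * D := by gcongr
            _ = D := by rw [← add_mul, hst, one_mul])
      by_cases h : g⁻¹ * a ∈ H
      · exact Or.inl ⟨a, ⟨ha, h⟩, haz⟩
      · exact Or.inr ⟨a, ⟨ha, h⟩, haz⟩)
    ⟨x, left_mem_segment ℝ x y, g, ⟨hg, by simp⟩, hgx⟩
    ⟨y, right_mem_segment ℝ x y, g', ⟨hg', hH⟩, hgy⟩
  refine hbH ?_
  have := mul_mem haH (hsame z hz a ha b hb haz hbz)
  simpa [mul_assoc] using this

end

theorem exists_dual_vanishing_on_fixedPoints {n : ℕ} {x : Fin n → ℝ}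
    (hx : Function.Injective x) {g : Equiv.Perm (Fin n)} (hg1 : g ≠ 1) (hgs : ¬ g.IsSwap) :
    ∃ φ : Module.Dual ℝ (Fin n → ℝ), (∃ v, φ v ≠ 0) ∧ φ x = 0 ∧
      ∀ v, permAct g v = v → φ v = 0 := by
  obtain ⟨a, ha⟩ : ∃ a, g a ≠ a := by
    by_contra! h
    exact hg1 (Equiv.ext h)
  obtain ⟨b, hba, hbga, hb⟩ : ∃ b, b ≠ a ∧ b ≠ g a ∧ g b ≠ b := by
    by_contra! h
    refine hgs ⟨a, g a, ha.symm, Equiv.ext fun c => ?_⟩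
    have hinj := g.injective
    rw [Equiv.swap_apply_def]
    split_ifs with h₁ h₂
    · rw [h₁]
    · by_contra hne
      have h₃ := h (g (g a)) (by rwa [h₂] at hne) (fun h => ha (hinj h))
      exact ha (hinj (hinj h₃))
    · exact h c h₁ h₂
  let f : Fin n → Module.Dual ℝ (Fin n → ℝ) := fun c =>
    (LinearMap.proj c : Module.Dual ℝ (Fin n → ℝ)) - LinearMap.proj (g c)
  have hf : ∀ c v, f c v = v c - v (g c) := fun c v => rfl
  refine ⟨f a x • f b - f b x • f a, ⟨Pi.single b 1, ?_⟩, ?_, fun v hv => ?_⟩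
  · have h₁ : f a x ≠ 0 := by
      rw [hf, sub_ne_zero]
      exact fun h => ha (hx h).symm
    simpa [hf, hb, hba.symm, hbga.symm] using h₁
  · simp [mul_comm]
  · simp [hf, apply_perm_of_permAct_eq hv]

theorem permAct_ne_of_mem_segment {n : ℕ} {x y : Fin n → ℝ} (hx : Function.Injective x)
    {g : Equiv.Perm (Fin n)} (hg1 : g ≠ 1) {φ : Module.Dual ℝ (Fin n → ℝ)} (hφx : φ x = 0)
    (hφ : ∀ v, permAct g v = v → φ v = 0) (hφy : φ y ≠ 0) {z : Fin n → ℝ}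
    (hz : z ∈ segment ℝ x y) : permAct g z ≠ z := by
  obtain ⟨s, t, hs, ht, hst, rfl⟩ := hz
  intro h
  have h₁ := hφ _ h
  have ht0 : t = 0 := by simpa [hφx, hφy] using h₁
  subst ht0
  have hs1 : s = 1 := by linarith
  subst hs1
  simp only [one_smul, zero_smul, add_zero] at h
  exact hg1 (Equiv.ext fun i => hx (apply_perm_of_permAct_eq h i))

theorem not_exists_finite_generators {n : ℕ} {G : Subgroup (Equiv.Perm (Fin n))}
    (hG : Subgroup.closure {σ : Equiv.Perm (Fin n) | σ.IsSwap ∧ σ ∈ G} ≠ G)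
    {l : Fin n → ((Fin n → ℝ) →ₗ[ℝ] ℝ)} (hli : LinearIndependent ℝ l) :
    ¬ ∃ S : Finset (Fin n → ℕ), ↑S ⊆ initialMonoid G l ∧
        ∀ u ∈ initialMonoid G l, u ∈ AddSubmonoid.closure (S : Set (Fin n → ℕ)) := by
  rintro ⟨S, hS, hgen⟩
  set H := Subgroup.closure {σ : Equiv.Perm (Fin n) | σ.IsSwap ∧ σ ∈ G} with hH
  have hHG : H ≤ G := (Subgroup.closure_le G).2 fun σ hσ => hσ.2
  obtain ⟨g₀, hg₀, hg₀H⟩ := SetLike.exists_of_lt (lt_of_le_of_ne hHG hG)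
  have hne1 : ∀ g ∈ G, g ∉ H → g ≠ 1 := fun g _ hgH h => hgH (h ▸ one_mem H)
  have hnsw : ∀ g ∈ G, g ∉ H → ¬ g.IsSwap := fun g hg hgH h =>
    hgH (Subgroup.subset_closure ⟨h, hg⟩)
  let x : Bool → Fin n → ℝ := fun b =>
    permAct (if b then g₀ else 1) (fun i => ((i : ℕ) : ℝ))
  have hxinj : ∀ b, Function.Injective (x b) := fun b =>
    (Nat.cast_injective.comp Fin.val_injective).comp (Equiv.injective _)
  have hx0 : ∀ b i, 0 ≤ x b i := fun b i => Nat.cast_nonneg _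
  have hx : x true = permAct g₀ (x false) := by simp [x, permAct_one]
  choose φ hφ hφx hφfix using fun p : Bool × {g // g ∈ G ∧ g ∉ H} =>
    exists_dual_vanishing_on_fixedPoints (hxinj p.1) (hne1 p.2 p.2.2.1 p.2.2.2)
      (hnsw p.2 p.2.2.1 p.2.2.2)
  obtain ⟨y₀, hy₀⟩ := Module.Dual.exists_forall_ne_zero_of_forall_exists φ hφ
  obtain ⟨c, hc⟩ : ∃ c : ℝ, ∀ i, 0 ≤ y₀ i + c := by
    refine ⟨∑ i, |y₀ i|, fun i => ?_⟩
    have h₁ := Finset.single_le_sum (f := fun i => |y₀ i|) (fun i _ => abs_nonneg _)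
      (Finset.mem_univ i)
    have h₂ := neg_abs_le (y₀ i)
    linarith
  let y : Fin n → ℝ := y₀ + fun _ => c
  have hy : ∀ p, φ p y ≠ 0 := fun p => by
    rw [map_add, hφfix p (fun _ => c) rfl, add_zero]
    exact hy₀ p
  have hseg : ∀ b, ∀ z ∈ segment ℝ (x b) y, ∀ g ∈ G, g ∉ H → permAct g z ≠ z :=
    fun b z hz g hg hgH => permAct_ne_of_mem_segment (hxinj b) (hne1 g hg hgH)
      (hφx (b, ⟨g, hg, hgH⟩)) (hφfix (b, ⟨g, hg, hgH⟩)) (hy _) hz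
  have hxD : ∀ b, ∑ i, x b i ≤ max (∑ i, x false i) (∑ i, y i) := fun b => by
    refine le_trans (le_of_eq ?_) (le_max_left _ _)
    rw [sum_permAct, sum_permAct]
  obtain ⟨g, hg, hgx⟩ := exists_permAct_mem_boundedCone hgen (hx0 false) (hxD false)
  obtain ⟨g', hg', hgy⟩ := exists_permAct_mem_boundedCone hgen hc (le_max_right (∑ i, x false i) _)
  have hgx' : permAct (g * g₀⁻¹) (x true) ∈
      boundedCone S (max (∑ i, x false i) (∑ i, y i)) := by
    rwa [hx, permAct_mul, permAct_inv_cancel]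
  have h₁ := inv_mul_mem_of_segment hli hS hgen (hx0 false) hc (hseg false) hg hg' (hxD false)
    (le_max_right _ _) hgx hgy
  have h₂ := inv_mul_mem_of_segment hli hS hgen (hx0 true) hc (hseg true)
    (mul_mem hg (inv_mem hg₀)) hg' (hxD true) (le_max_right _ _) hgx' hgy
  refine hg₀H ?_
  have := mul_mem h₂ (inv_mem h₁)
  simpa [mul_assoc] using this

theorem mem_closure_irreducibles {n : ℕ} {M : Set (Fin n → ℕ)} {u : Fin n → ℕ} (hu : u ∈ M) :
    u ∈ AddSubmonoid.closure {u : Fin n → ℕ | u ∈ M ∧ u ≠ 0 ∧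
      ¬ ∃ a ∈ M, ∃ b ∈ M, a ≠ 0 ∧ b ≠ 0 ∧ u = a + b} := by
  induction hd : ∑ i, u i using Nat.strong_induction_on generalizing u with
  | _ d ih =>
    by_cases h0 : u = 0
    · rw [h0]
      exact zero_mem _
    by_cases hirr : ∃ a ∈ M, ∃ b ∈ M, a ≠ 0 ∧ b ≠ 0 ∧ u = a + b
    · obtain ⟨a, ha, b, hb, ha0, hb0, rfl⟩ := hirr
      have hpos : ∀ v : Fin n → ℕ, v ≠ 0 → 0 < ∑ i, v i := fun v hv =>
        Finset.sum_pos_iff.2 (by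
          obtain ⟨i, hi⟩ := Function.ne_iff.1 hv
          exact ⟨i, Finset.mem_univ i, Nat.pos_of_ne_zero hi⟩)
      have hab : ∑ i, a i + ∑ i, b i = d := by
        rw [← hd, ← Finset.sum_add_distrib]
        rfl
      have hapos := hpos a ha0
      have hbpos := hpos b hb0
      exact add_mem (ih _ (by omega) ha rfl) (ih _ (by omega) hb rfl)
    · exact AddSubmonoid.subset_closure ⟨hu, h0, hirr⟩

/-- if G is not generated by transpositions, then for any
admissible term order the monoid of initial exponents of invariants has
infinitely many irreducible elements; consequently it is not finitely
generated, so the invariant ring has no finite SAGBI basis. -/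
theorem stmt_19 (n : ℕ) (G : Subgroup (Equiv.Perm (Fin n)))
    (hgen : Subgroup.closure {σ : Equiv.Perm (Fin n) | σ.IsSwap ∧ σ ∈ G} ≠ G)
    (l : Fin n → ((Fin n → ℝ) →ₗ[ℝ] ℝ)) (hli : LinearIndependent ℝ l)
    (hord : ∀ i j : Fin n, i < j → lexGt fun k => l k (Pi.single i 1 - Pi.single j 1)) :
    {u : Fin n → ℕ | u ∈ initialMonoid G l ∧ u ≠ 0 ∧
      ¬ ∃ a ∈ initialMonoid G l, ∃ b ∈ initialMonoid G l,
        a ≠ 0 ∧ b ≠ 0 ∧ u = a + b}.Infinite ∧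
    ¬ ∃ S : Finset (Fin n → ℕ), ↑S ⊆ initialMonoid G l ∧
        ∀ u ∈ initialMonoid G l, u ∈ AddSubmonoid.closure (S : Set (Fin n → ℕ)) := by
  refine ⟨fun hfin => ?_, not_exists_finite_generators hgen hli⟩
  refine not_exists_finite_generators hgen hli ⟨hfin.toFinset, ?_, fun u hu => ?_⟩
  · rw [hfin.coe_toFinset]
    exact fun u hu => hu.1
  · rw [hfin.coe_toFinset]
    exact mem_closure_irreducibles hu
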